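/- arXiv:2305.07751 — 6 statements merged into one kernel-verified Lean document; each statement's English description precedes it below -/
import Mathlib

section
/- Let p and q be probability mass functions on a finite set of cardinality c, and let Δ = Σ_x |p(x) − q(x)| be their L1 distance. If 0 < Δ ≤ 1/2, then |H(p) − H(q)| ≤ Δ · log₂(c/Δ). -/
open Real in
theorem negMulLog_one_sub_le {d : ℝ} (h0 : 0 ≤ d) (h1 : d ≤ 1 / 2) :
    negMulLog (1 - d) ≤ negMulLog d := by
  rcases h0.eq_or_lt with rfl | hd
  · simp
  have hd' : 0 < 1 - d := by linarith
  have h := strictConcaveOn_log_Ioi.concaveOn.2 (Set.mem_Ioi.2 hd) (Set.mem_Ioi.2 one_pos)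
    (show 0 ≤ d / (1 - d) by positivity)
    (show 0 ≤ (1 - 2 * d) / (1 - d) from div_nonneg (by linarith) hd'.le) (by field_simp; ring)
  have e : (d / (1 - d)) • d + ((1 - 2 * d) / (1 - d)) • (1 : ℝ) = 1 - d := by
    simp only [smul_eq_mul]; field_simp; ring
  rw [e, log_one, smul_zero, add_zero, smul_eq_mul, div_mul_eq_mul_div, div_le_iff₀ hd'] at h
  simp only [negMulLog]
  linarith

open Real in
theorem negMulLog_add_le {a b : ℝ} (ha : 0 ≤ a) (hb : 0 ≤ b) :
    negMulLog (a + b) ≤ negMulLog a + negMulLog b := by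
  rcases ha.eq_or_lt with rfl | ha'
  · simp
  rcases hb.eq_or_lt with rfl | hb'
  · simp
  have h1 := mul_le_mul_of_nonneg_left (log_le_log ha' (by linarith : a ≤ a + b)) ha
  have h2 := mul_le_mul_of_nonneg_left (log_le_log hb' (by linarith : b ≤ a + b)) hb
  simp only [negMulLog]
  linarith

open Real in
theorem negMulLog_sub_negMulLog_add_le {a d : ℝ} (ha : 0 ≤ a) (hd : 0 ≤ d) (had : a + d ≤ 1) :
    negMulLog a - negMulLog (a + d) ≤ negMulLog (1 - d) := by
  rcases hd.eq_or_lt with rfl | hd'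
  · simp
  have h1a : 0 < 1 - a := by linarith
  have hs : 0 ≤ (1 - a - d) / (1 - a) := div_nonneg (by linarith) h1a.le
  have ht : 0 ≤ d / (1 - a) := by positivity
  have hst : (1 - a - d) / (1 - a) + d / (1 - a) = 1 := by field_simp; ring
  have hone : (1 : ℝ) ∈ Set.Ici (0 : ℝ) := Set.mem_Ici.2 zero_le_one
  have h1 := concaveOn_negMulLog.2 (Set.mem_Ici.2 ha) hone hs ht hst
  have h2 := concaveOn_negMulLog.2 (Set.mem_Ici.2 ha) hone ht hs (by rw [add_comm, hst])
  have e1 : (1 - a - d) / (1 - a) * a + d / (1 - a) * 1 = a + d := by field_simp; ring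
  have e2 : d / (1 - a) * a + (1 - a - d) / (1 - a) * 1 = 1 - d := by field_simp; ring
  simp only [smul_eq_mul, negMulLog_one, e1, e2, mul_zero, add_zero] at h1 h2
  have h3 : negMulLog a =
      (1 - a - d) / (1 - a) * negMulLog a + d / (1 - a) * negMulLog a := by
    rw [← add_mul, hst, one_mul]
  linarith

open Real in
theorem abs_negMulLog_sub_le {a b : ℝ} (ha0 : 0 ≤ a) (ha1 : a ≤ 1) (hb0 : 0 ≤ b) (hb1 : b ≤ 1)
    (hab : |a - b| ≤ 1 / 2) : |negMulLog a - negMulLog b| ≤ negMulLog |a - b| := by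
  wlog h : b ≤ a generalizing a b
  · rw [abs_sub_comm, abs_sub_comm a b]
    exact this hb0 hb1 ha0 ha1 (by rwa [abs_sub_comm]) (le_of_not_ge h)
  have hd : 0 ≤ a - b := sub_nonneg.2 h
  rw [abs_of_nonneg hd] at hab ⊢
  have h1 := negMulLog_add_le hb0 hd
  have h2 := negMulLog_sub_negMulLog_add_le hb0 hd (by linarith)
  have h3 := negMulLog_one_sub_le hd hab
  rw [add_sub_cancel] at h1 h2
  exact abs_le.2 ⟨by linarith, by linarith⟩

open Real in
theorem negMulLog_le_tangent {d m : ℝ} (hd : 0 ≤ d) (hm : 0 < m) :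
    negMulLog d ≤ m - d - d * log m := by
  have h := mul_le_mul_of_nonneg_left
    (negMulLog_le_one_sub_self (div_nonneg hd hm.le)) hm.le
  have e := negMulLog_mul (d / m) m
  rw [div_mul_cancel₀ d hm.ne'] at e
  have e2 : d / m * negMulLog m = - (d * log m) := by simp only [negMulLog]; field_simp
  have e3 : m * (1 - d / m) = m - d := by field_simp
  linarith

open Real in
theorem sum_negMulLog_le {ι : Type*} [Fintype ι] {d : ι → ℝ} (hd : ∀ i, 0 ≤ d i)
    (hsum : 0 < ∑ i, d i) :
    ∑ i, negMulLog (d i) ≤ (∑ i, d i) * log (Fintype.card ι / ∑ i, d i) := by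
  have : Nonempty ι := by
    by_contra hne
    rw [not_nonempty_iff] at hne
    simp at hsum
  have hc : (0 : ℝ) < Fintype.card ι := Nat.cast_pos.2 Fintype.card_pos
  have h := Finset.sum_le_sum fun i (_ : i ∈ Finset.univ) =>
    negMulLog_le_tangent (hd i) (div_pos hsum hc)
  rw [Finset.sum_sub_distrib, Finset.sum_sub_distrib, ← Finset.sum_mul, Finset.sum_const,
    Finset.card_univ, nsmul_eq_mul, mul_div_cancel₀ _ hc.ne', sub_self, zero_sub] at h
  rw [← inv_div, log_inv, mul_neg]
  exact h


/-- If `p` and `q` are probability mass functions on a finite set of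
cardinality `c` whose L1 distance `Δ` satisfies `0 < Δ ≤ 1/2`, then the Shannon entropies
(base 2) satisfy `|H(p) − H(q)| ≤ Δ · log₂ (c / Δ)`. -/
theorem stmt_0 {S : Type*} [Fintype S]
    (p q : S → ℝ)
    (hp0 : ∀ x, 0 ≤ p x) (hp1 : ∑ x, p x = 1)
    (hq0 : ∀ x, 0 ≤ q x) (hq1 : ∑ x, q x = 1)
    (Δ : ℝ) (hΔ : Δ = ∑ x, |p x - q x|)
    (hΔpos : 0 < Δ) (hΔle : Δ ≤ 1 / 2) :
    |(- ∑ x, p x * Real.logb 2 (p x)) - (- ∑ x, q x * Real.logb 2 (q x))|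
      ≤ Δ * Real.logb 2 ((Fintype.card S : ℝ) / Δ) := by
  have entropy_eq (r : S → ℝ) :
      - ∑ x, r x * Real.logb 2 (r x) = (∑ x, Real.negMulLog (r x)) / Real.log 2 := by
    simp only [Real.logb, Real.negMulLog, Finset.sum_div, ← Finset.sum_neg_distrib]
    exact Finset.sum_congr rfl fun x _ => by ring
  have hlog : 0 < Real.log 2 := Real.log_pos one_lt_two
  have le_one {r : S → ℝ} (h0 : ∀ x, 0 ≤ r x) (h1 : ∑ x, r x = 1) (x : S) : r x ≤ 1 :=
    h1 ▸ Finset.single_le_sum (fun y _ => h0 y) (Finset.mem_univ x)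
  have hdist (x : S) : |p x - q x| ≤ 1 / 2 :=
    (Finset.single_le_sum (f := fun y => |p y - q y|) (fun y _ => abs_nonneg _)
      (Finset.mem_univ x)).trans (hΔ ▸ hΔle)
  rw [entropy_eq, entropy_eq, ← sub_div, abs_div, abs_of_pos hlog, Real.logb, ← mul_div_assoc,
    div_le_div_iff_of_pos_right hlog, ← Finset.sum_sub_distrib]
  calc |∑ x, (Real.negMulLog (p x) - Real.negMulLog (q x))|
      ≤ ∑ x, |Real.negMulLog (p x) - Real.negMulLog (q x)| := Finset.abs_sum_le_sum_abs _ _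
    _ ≤ ∑ x, Real.negMulLog |p x - q x| := Finset.sum_le_sum fun x _ =>
        abs_negMulLog_sub_le (hp0 x) (le_one hp0 hp1 x) (hq0 x) (le_one hq0 hq1 x) (hdist x)
    _ ≤ Δ * Real.log (Fintype.card S / Δ) := by
        rw [hΔ] at hΔpos ⊢
        exact sum_negMulLog_le (fun x => abs_nonneg _) hΔpos
end

section
/- Let X = (X_1, …, X_d) be a random vector where each X_i takes values in a finite set, and suppose the joint probability mass function factorizes along a rooted tree T on vertex set {1,…,d} with root r and parent map pa, i.e., Pr[X = x] = Pr[X_r = x_r] · Π_{i ≠ r} Pr[X_i = x_i | X_{pa(i)} = x_{pa(i)}] for all x. Then for every tree T' on vertex set {1,…,d} (rooted arbitrarily, with parent map pa'), Σ_{i ≠ root(T')} I(X_i ; X_{pa'(i)}) ≤ Σ_{i ≠ r} I(X_i ; X_{pa(i)}). -/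
open Finset

/-- Shannon entropy (natural log) of a probability mass function on a finite type. -/
noncomputable def entropy {T : Type*} [Fintype T] (f : T → ℝ) : ℝ :=
  - ∑ a, f a * Real.log (f a)

/-- The marginal distribution of coordinate `i` of a joint pmf `P`. -/
noncomputable def marginal {d : ℕ} {S : Fin d → Type*} [∀ i, Fintype (S i)]
    [∀ i, DecidableEq (S i)] (P : (∀ i, S i) → ℝ) (i : Fin d) (a : S i) : ℝ :=
  ∑ x, if x i = a then P x else 0

/-- The joint marginal distribution of coordinates `i` and `j` of a joint pmf `P`. -/
noncomputable def pairMarginal {d : ℕ} {S : Fin d → Type*} [∀ i, Fintype (S i)]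
    [∀ i, DecidableEq (S i)] (P : (∀ i, S i) → ℝ) (i j : Fin d) (ab : S i × S j) : ℝ :=
  ∑ x, if x i = ab.1 ∧ x j = ab.2 then P x else 0

/-- Mutual information `I(X_i; X_j) = H(X_i) + H(X_j) − H(X_i, X_j)`. -/
noncomputable def mutualInfo {d : ℕ} {S : Fin d → Type*} [∀ i, Fintype (S i)]
    [∀ i, DecidableEq (S i)] (P : (∀ i, S i) → ℝ) (i j : Fin d) : ℝ :=
  entropy (marginal P i) + entropy (marginal P j) - entropy (pairMarginal P i j)

/-- Resampling coordinate `j` in all possible ways counts every point `card (S j)` times. -/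
theorem sum_sum_update {ι : Type*} [Fintype ι] [DecidableEq ι] {S : ι → Type*}
    [∀ i, Fintype (S i)] (f : (∀ i, S i) → ℝ) (j : ι) :
    ∑ x, ∑ a, f (Function.update x j a) = Fintype.card (S j) * ∑ x, f x := by
  have hinv : Function.Involutive
      (fun p : (∀ i, S i) × S j => (Function.update p.1 j p.2, p.1 j)) := by
    rintro ⟨x, a⟩
    simp
  have h := Equiv.sum_comp hinv.toPerm (fun p : (∀ i, S i) × S j => f p.1)
  simp only [Fintype.sum_prod_type, Function.Involutive.coe_toPerm] at h
  rw [h, Finset.mul_sum]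
  simp

/-- A product of conditional (sub)probabilities, where each factor depends only on its own
coordinate and on coordinates of smaller rank, has total mass at most one. -/
theorem sum_prod_le_one {ι : Type*} [Fintype ι] [DecidableEq ι] {S : ι → Type*}
    [∀ i, Fintype (S i)] (g : ι → (∀ i, S i) → ℝ) (rank : ι → ℕ)
    (hg : ∀ i x, 0 ≤ g i x)
    (hsum : ∀ i x, ∑ a, g i (Function.update x i a) ≤ 1)
    (hdep : ∀ i j x a, i ≠ j → rank i ≤ rank j → g i (Function.update x j a) = g i x) :
    ∑ x, ∏ i, g i x ≤ 1 := by
  have key : ∀ s : Finset ι,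
      ∑ x, ∏ i ∈ s, g i x ≤ ∏ i ∈ sᶜ, (Fintype.card (S i) : ℝ) := by
    intro s
    induction s using Finset.induction_on_max_value rank with
    | empty => simp
    | insert j s hj hmax ih =>
      rcases isEmpty_or_nonempty (S j) with hE | hN
      · have : IsEmpty (∀ i, S i) := ⟨fun x => hE.elim (x j)⟩
        simp only [Finset.univ_eq_empty, Finset.sum_empty]
        positivity
      · have hpos : (0 : ℝ) < Fintype.card (S j) := by exact_mod_cast Fintype.card_pos
        refine le_of_mul_le_mul_left ?_ hpos
        have hcompl : sᶜ = insert j (insert j s)ᶜ := by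
          ext i
          by_cases h : i = j <;> simp [h, hj]
        calc (Fintype.card (S j) : ℝ) * ∑ x, ∏ i ∈ insert j s, g i x
            = ∑ x, ∑ a, ∏ i ∈ insert j s, g i (Function.update x j a) :=
              (sum_sum_update _ j).symm
          _ = ∑ x, (∑ a, g j (Function.update x j a)) * ∏ i ∈ s, g i x := by
              refine Finset.sum_congr rfl fun x _ => ?_
              rw [Finset.sum_mul]
              refine Finset.sum_congr rfl fun a _ => ?_
              rw [Finset.prod_insert hj]
              congr 1
              refine Finset.prod_congr rfl fun i hi => ?_
              exact hdep i j x a (fun h => hj (h ▸ hi)) (hmax i hi)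
          _ ≤ ∑ x, ∏ i ∈ s, g i x := by
              refine Finset.sum_le_sum fun x _ => ?_
              exact mul_le_of_le_one_left (Finset.prod_nonneg fun i _ => hg i x) (hsum j x)
          _ ≤ ∏ i ∈ sᶜ, (Fintype.card (S i) : ℝ) := ih
          _ = Fintype.card (S j) * ∏ i ∈ (insert j s)ᶜ, (Fintype.card (S i) : ℝ) := by
              rw [hcompl, Finset.prod_insert (by simp)]
  simpa using key Finset.univ

/-- Gibbs' inequality against a subprobability mass function. -/
theorem sum_mul_log_le_sum_mul_log {T : Type*} [Fintype T] (p q : T → ℝ)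
    (hp : ∀ x, 0 ≤ p x) (hp1 : ∑ x, p x = 1) (hq : ∀ x, 0 ≤ q x) (hq1 : ∑ x, q x ≤ 1)
    (hpq : ∀ x, 0 < p x → 0 < q x) :
    ∑ x, p x * Real.log (q x) ≤ ∑ x, p x * Real.log (p x) := by
  have h : ∀ x, p x * Real.log (q x) ≤ p x * Real.log (p x) + (q x - p x) := by
    intro x
    rcases (hp x).eq_or_lt with h0 | h0
    · simp [← h0, hq x]
    · have hlog := Real.log_le_sub_one_of_pos (div_pos (hpq x h0) h0)
      rw [Real.log_div (hpq x h0).ne' h0.ne'] at hlog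
      have hmul := mul_le_mul_of_nonneg_left hlog h0.le
      have : p x * (q x / p x - 1) = q x - p x := by field_simp
      linarith
  have hs := Finset.sum_le_sum fun x (_ : x ∈ Finset.univ) => h x
  rw [Finset.sum_add_distrib, Finset.sum_sub_distrib] at hs
  linarith

section Marginals

variable {d : ℕ} {S : Fin d → Type*} [∀ i, Fintype (S i)] [∀ i, DecidableEq (S i)]
  {P : (∀ i, S i) → ℝ}

theorem marginal_nonneg (hP0 : ∀ x, 0 ≤ P x) (i : Fin d) (a : S i) : 0 ≤ marginal P i a :=
  Finset.sum_nonneg fun x _ => by split_ifs <;> simp [hP0 x]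

theorem pairMarginal_nonneg (hP0 : ∀ x, 0 ≤ P x) (i j : Fin d) (ab : S i × S j) :
    0 ≤ pairMarginal P i j ab :=
  Finset.sum_nonneg fun x _ => by split_ifs <;> simp [hP0 x]

theorem le_marginal (hP0 : ∀ x, 0 ≤ P x) (i : Fin d) (x : ∀ i, S i) :
    P x ≤ marginal P i (x i) := by
  have h := Finset.single_le_sum (f := fun y => if y i = x i then P y else 0)
    (fun y _ => by split_ifs <;> simp [hP0 y]) (Finset.mem_univ x)
  simpa [marginal] using h

theorem le_pairMarginal (hP0 : ∀ x, 0 ≤ P x) (i j : Fin d) (x : ∀ i, S i) :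
    P x ≤ pairMarginal P i j (x i, x j) := by
  have h := Finset.single_le_sum (f := fun y => if y i = x i ∧ y j = x j then P y else 0)
    (fun y _ => by split_ifs <;> simp [hP0 y]) (Finset.mem_univ x)
  simpa [pairMarginal] using h

theorem sum_marginal (P : (∀ i, S i) → ℝ) (i : Fin d) : ∑ a, marginal P i a = ∑ x, P x := by
  unfold marginal
  rw [Finset.sum_comm]
  simp

theorem sum_pairMarginal_left (P : (∀ i, S i) → ℝ) (i j : Fin d) (b : S j) :
    ∑ a, pairMarginal P i j (a, b) = marginal P j b := by
  unfold marginal pairMarginal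
  rw [Finset.sum_comm]
  refine Finset.sum_congr rfl fun x _ => ?_
  simp [ite_and]

theorem sum_mul_log_marginal (P : (∀ i, S i) → ℝ) (i : Fin d) :
    ∑ x, P x * Real.log (marginal P i (x i)) = -entropy (marginal P i) := by
  rw [entropy, neg_neg]
  conv_rhs =>
    enter [2, a]
    rw [marginal.eq_1 P i a, Finset.sum_mul]
  rw [Finset.sum_comm]
  refine Finset.sum_congr rfl fun x _ => ?_
  simp only [← marginal.eq_1, ite_mul, zero_mul, Finset.sum_ite_eq, Finset.mem_univ, if_true]

theorem sum_mul_log_pairMarginal (P : (∀ i, S i) → ℝ) (i j : Fin d) :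
    ∑ x, P x * Real.log (pairMarginal P i j (x i, x j)) = -entropy (pairMarginal P i j) := by
  have h : ∀ ab : S i × S j,
      pairMarginal P i j ab * Real.log (pairMarginal P i j ab) =
        ∑ x, if (x i, x j) = ab then P x * Real.log (pairMarginal P i j ab) else 0 := by
    intro ab
    nth_rewrite 1 [pairMarginal]
    simp only [Finset.sum_mul, ite_mul, zero_mul, Prod.ext_iff]
  rw [entropy, neg_neg, Finset.sum_congr rfl fun ab _ => h ab, Finset.sum_comm]
  simp

/-- The distribution obtained from `P` by keeping its marginal at the root `r` and its
transition probabilities along the edges of the tree with parent map `pa`. -/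
noncomputable def treeDensity (P : (∀ i, S i) → ℝ) (r : Fin d) (pa : Fin d → Fin d)
    (x : ∀ i, S i) : ℝ :=
  marginal P r (x r) * ∏ i ∈ Finset.univ.erase r,
    pairMarginal P i (pa i) (x i, x (pa i)) / marginal P (pa i) (x (pa i))

theorem treeDensity_nonneg (hP0 : ∀ x, 0 ≤ P x) (r : Fin d) (pa : Fin d → Fin d)
    (x : ∀ i, S i) : 0 ≤ treeDensity P r pa x :=
  mul_nonneg (marginal_nonneg hP0 _ _) <| Finset.prod_nonneg fun _ _ =>
    div_nonneg (pairMarginal_nonneg hP0 _ _ _) (marginal_nonneg hP0 _ _)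

theorem treeDensity_pos (hP0 : ∀ x, 0 ≤ P x) (r : Fin d) (pa : Fin d → Fin d)
    {x : ∀ i, S i} (hx : 0 < P x) : 0 < treeDensity P r pa x :=
  mul_pos (hx.trans_le (le_marginal hP0 _ _)) <| Finset.prod_pos fun _ _ =>
    div_pos (hx.trans_le (le_pairMarginal hP0 _ _ _)) (hx.trans_le (le_marginal hP0 _ _))

theorem sum_treeDensity_le_one (hP0 : ∀ x, 0 ≤ P x) (hP1 : ∑ x, P x = 1)
    (r : Fin d) (pa : Fin d → Fin d) (htree : ∀ i, ∃ n, pa^[n] i = r) :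
    ∑ x, treeDensity P r pa x ≤ 1 := by
  classical
  let depth : Fin d → ℕ := fun i => Nat.find (htree i)
  have hdepth : ∀ i, i ≠ r → depth (pa i) < depth i := by
    intro i hi
    obtain ⟨m, hm⟩ : ∃ m, depth i = m + 1 := by
      refine Nat.exists_eq_succ_of_ne_zero fun h0 => hi ?_
      have := Nat.find_spec (htree i)
      rwa [show Nat.find (htree i) = 0 from h0] at this
    have hspec : pa^[depth i] i = r := Nat.find_spec (htree i)
    rw [hm, Function.iterate_succ_apply] at hspec
    have : depth (pa i) ≤ m := Nat.find_min' (htree (pa i)) hspec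
    omega
  let g : Fin d → (∀ i, S i) → ℝ := fun i x =>
    if i = r then marginal P i (x i)
    else pairMarginal P i (pa i) (x i, x (pa i)) / marginal P (pa i) (x (pa i))
  have hprod : ∀ x, treeDensity P r pa x = ∏ i, g i x := by
    intro x
    rw [← Finset.mul_prod_erase _ _ (Finset.mem_univ r), treeDensity]
    congr 1
    · simp [g]
    · refine Finset.prod_congr rfl fun i hi => ?_
      simp [g, Finset.ne_of_mem_erase hi]
  simp only [hprod]
  refine sum_prod_le_one g depth ?_ ?_ ?_
  · intro i x
    by_cases h : i = r
    · simp only [g, if_pos h, marginal_nonneg hP0]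
    · simp only [g, if_neg h]
      exact div_nonneg (pairMarginal_nonneg hP0 _ _ _) (marginal_nonneg hP0 _ _)
  · intro i x
    by_cases h : i = r
    · simp only [g, if_pos h, Function.update_self, sum_marginal, hP1, le_refl]
    · have hne : pa i ≠ i := fun he => by
        have := hdepth i h
        rw [he] at this
        exact this.false
      simp only [g, if_neg h, Function.update_self, Function.update_of_ne hne]
      rw [← Finset.sum_div, sum_pairMarginal_left]
      exact div_self_le_one _
  · intro i j x a hij hle
    by_cases h : i = r
    · simp only [g, if_pos h, Function.update_of_ne hij]
    · have hne : pa i ≠ j := fun he => by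
        have := hdepth i h
        rw [he] at this
        omega
      simp only [g, if_neg h, Function.update_of_ne hij, Function.update_of_ne hne]

/-- The negative cross-entropy of `P` relative to a tree density. -/
theorem sum_mul_log_treeDensity (hP0 : ∀ x, 0 ≤ P x) (r : Fin d) (pa : Fin d → Fin d) :
    ∑ x, P x * Real.log (treeDensity P r pa x) =
      ∑ i ∈ Finset.univ.erase r, mutualInfo P i (pa i) - ∑ i, entropy (marginal P i) := by
  have hlog : ∀ x, P x * Real.log (treeDensity P r pa x) =
      P x * Real.log (marginal P r (x r)) + ∑ i ∈ Finset.univ.erase r,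
        (P x * Real.log (pairMarginal P i (pa i) (x i, x (pa i))) -
          P x * Real.log (marginal P (pa i) (x (pa i)))) := by
    intro x
    rcases (hP0 x).eq_or_lt with h0 | h0
    · simp [← h0]
    · have hm : ∀ i, marginal P i (x i) ≠ 0 := fun i =>
        (h0.trans_le (le_marginal hP0 i x)).ne'
      have hpm : ∀ i j, pairMarginal P i j (x i, x j) ≠ 0 := fun i j =>
        (h0.trans_le (le_pairMarginal hP0 i j x)).ne'
      have hdiv : ∀ i ∈ Finset.univ.erase r,
          pairMarginal P i (pa i) (x i, x (pa i)) / marginal P (pa i) (x (pa i)) ≠ 0 :=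
        fun i _ => div_ne_zero (hpm _ _) (hm _)
      rw [treeDensity, Real.log_mul (hm r) (Finset.prod_ne_zero_iff.mpr hdiv),
        Real.log_prod hdiv, mul_add, Finset.mul_sum]
      congr 1
      refine Finset.sum_congr rfl fun i _ => ?_
      rw [Real.log_div (hpm _ _) (hm _), mul_sub]
  rw [Finset.sum_congr rfl fun x _ => hlog x, Finset.sum_add_distrib, Finset.sum_comm,
    sum_mul_log_marginal, ← Finset.add_sum_erase _ _ (Finset.mem_univ r)]
  simp only [Finset.sum_sub_distrib, sum_mul_log_marginal, sum_mul_log_pairMarginal, mutualInfo,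
    Finset.sum_add_distrib, Finset.sum_neg_distrib]
  ring

end Marginals

/-- If the joint pmf of `X = (X_1, …, X_d)` factorizes along a rooted
tree with root `r` and parent map `pa`, then for every other rooted tree on the same
vertex set, with root `r'` and parent map `pa'`, we have
`Σ_{i ≠ r'} I(X_i ; X_{pa'(i)}) ≤ Σ_{i ≠ r} I(X_i ; X_{pa(i)})`. -/
theorem stmt_2 {d : ℕ} {S : Fin d → Type*} [∀ i, Fintype (S i)] [∀ i, DecidableEq (S i)]
    (P : (∀ i, S i) → ℝ) (hP0 : ∀ x, 0 ≤ P x) (hP1 : ∑ x, P x = 1)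
    (r : Fin d) (pa : Fin d → Fin d) (hr : pa r = r)
    (htree : ∀ i, ∃ n, pa^[n] i = r)
    (hfac : ∀ x, P x = marginal P r (x r) *
      ∏ i ∈ Finset.univ.erase r,
        pairMarginal P i (pa i) (x i, x (pa i)) / marginal P (pa i) (x (pa i)))
    (r' : Fin d) (pa' : Fin d → Fin d) (hr' : pa' r' = r')
    (htree' : ∀ i, ∃ n, pa'^[n] i = r') :
    ∑ i ∈ Finset.univ.erase r', mutualInfo P i (pa' i)
      ≤ ∑ i ∈ Finset.univ.erase r, mutualInfo P i (pa i) := by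
  have hP : treeDensity P r pa = P := funext fun x => (hfac x).symm
  have h := sum_mul_log_le_sum_mul_log P (treeDensity P r' pa') hP0 hP1
    (treeDensity_nonneg hP0 r' pa') (sum_treeDensity_le_one hP0 hP1 r' pa' htree')
    (fun _ => treeDensity_pos hP0 r' pa')
  have hT := sum_mul_log_treeDensity hP0 r pa
  rw [hP] at hT
  rw [sum_mul_log_treeDensity hP0 r' pa', hT] at h
  linarith
end

section
/- Let X = (X_1, …, X_d) be a random vector where each X_i takes values in a finite set, and suppose the joint probability mass function factorizes along a rooted tree T on vertex set {1,…,d} with root r and parent map pa, i.e., Pr[X = x] = Pr[X_r = x_r] · Π_{i ≠ r} Pr[X_i = x_i | X_{pa(i)} = x_{pa(i)}] for all x. Then for any three distinct vertices i, j, k of T such that k lies on the unique path in T between i and j, the conditional mutual information satisfies I(X_i ; X_j | X_k) = 0. -/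
open Finset

/-- The joint marginal distribution of coordinates `i`, `j` and `k` of a joint pmf `P`. -/
noncomputable def tripleMarginal {d : ℕ} {S : Fin d → Type*} [∀ i, Fintype (S i)]
    [∀ i, DecidableEq (S i)] (P : (∀ i, S i) → ℝ) (i j k : Fin d)
    (abc : S i × S j × S k) : ℝ :=
  ∑ x, if x i = abc.1 ∧ x j = abc.2.1 ∧ x k = abc.2.2 then P x else 0

/-- Conditional mutual information
`I(X_i; X_j | X_k) = H(X_i, X_k) + H(X_j, X_k) − H(X_i, X_j, X_k) − H(X_k)`. -/
noncomputable def condMutualInfo {d : ℕ} {S : Fin d → Type*} [∀ i, Fintype (S i)]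
    [∀ i, DecidableEq (S i)] (P : (∀ i, S i) → ℝ) (i j k : Fin d) : ℝ :=
  entropy (pairMarginal P i k) + entropy (pairMarginal P j k)
    - entropy (tripleMarginal P i j k) - entropy (marginal P k)

/-- The undirected graph of a rooted tree given by a parent map: `i` and `j` are
adjacent iff they are distinct and one is the parent of the other. -/
def parentGraph {d : ℕ} (pa : Fin d → Fin d) : SimpleGraph (Fin d) :=
  SimpleGraph.fromRel (fun i j => pa i = j)

/-- Entropy of a pushforward, written as an expectation over the original space. -/
theorem entropy_pushforward {Ω T : Type*} [Fintype Ω] [Fintype T] [DecidableEq T]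
    (P : Ω → ℝ) (f : Ω → T) :
    entropy (fun a => ∑ x, if f x = a then P x else 0) =
      -∑ x, P x * Real.log (∑ y, if f y = f x then P y else 0) := by
  unfold entropy
  congr 1
  simp_rw [Finset.sum_mul]
  rw [Finset.sum_comm]
  refine Finset.sum_congr rfl fun x _ => ?_
  simp [ite_mul]

theorem le_sum_ite {Ω : Type*} [Fintype Ω] {P : Ω → ℝ} (hP0 : ∀ x, 0 ≤ P x)
    (p : Ω → Prop) [DecidablePred p] (x : Ω) (hx : p x) : P x ≤ ∑ y, if p y then P y else 0 := by
  have h := Finset.single_le_sum (f := fun y => if p y then P y else 0)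
    (fun y _ => by split_ifs <;> simp [hP0]) (Finset.mem_univ x)
  simpa [hx] using h

section Marginals

variable {d : ℕ} {S : Fin d → Type*} [∀ i, Fintype (S i)] [∀ i, DecidableEq (S i)]
  {P : (∀ i, S i) → ℝ}

theorem entropy_marginal (P : (∀ i, S i) → ℝ) (i : Fin d) :
    entropy (marginal P i) = -∑ x, P x * Real.log (marginal P i (x i)) :=
  entropy_pushforward P fun x => x i

theorem entropy_pairMarginal (P : (∀ i, S i) → ℝ) (i j : Fin d) :
    entropy (pairMarginal P i j) =
      -∑ x, P x * Real.log (pairMarginal P i j (x i, x j)) := by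
  have h := entropy_pushforward P fun x => (x i, x j)
  simp only [Prod.ext_iff] at h
  exact h

theorem entropy_tripleMarginal (P : (∀ i, S i) → ℝ) (i j k : Fin d) :
    entropy (tripleMarginal P i j k) =
      -∑ x, P x * Real.log (tripleMarginal P i j k (x i, x j, x k)) := by
  have h := entropy_pushforward P fun x => (x i, x j, x k)
  simp only [Prod.ext_iff] at h
  exact h

/-- Conditional independence of `X_i` and `X_j` given `X_k` makes the conditional mutual
information vanish. -/
theorem condMutualInfo_eq_zero (hP0 : ∀ x, 0 ≤ P x) {i j k : Fin d}
    (h : ∀ a b c, tripleMarginal P i j k (a, b, c) * marginal P k c =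
      pairMarginal P i k (a, c) * pairMarginal P j k (b, c)) :
    condMutualInfo P i j k = 0 := by
  have key : ∀ x, P x * Real.log (tripleMarginal P i j k (x i, x j, x k)) +
      P x * Real.log (marginal P k (x k)) =
      P x * Real.log (pairMarginal P i k (x i, x k)) +
      P x * Real.log (pairMarginal P j k (x j, x k)) := by
    intro x
    rcases (hP0 x).eq_or_lt with h0 | h0
    · simp [← h0]
    · have ht : 0 < tripleMarginal P i j k (x i, x j, x k) :=
        h0.trans_le (le_sum_ite hP0 _ x ⟨rfl, rfl, rfl⟩)
      have hm : 0 < marginal P k (x k) := h0.trans_le (le_sum_ite hP0 _ x rfl)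
      have hp : 0 < pairMarginal P i k (x i, x k) :=
        h0.trans_le (le_sum_ite hP0 _ x ⟨rfl, rfl⟩)
      have hq : 0 < pairMarginal P j k (x j, x k) :=
        h0.trans_le (le_sum_ite hP0 _ x ⟨rfl, rfl⟩)
      rw [← mul_add, ← mul_add, ← Real.log_mul ht.ne' hm.ne', ← Real.log_mul hp.ne' hq.ne', h]
  have hsum := Finset.sum_congr (rfl : (Finset.univ : Finset (∀ i, S i)) = Finset.univ)
    fun x _ => key x
  rw [Finset.sum_add_distrib, Finset.sum_add_distrib] at hsum
  rw [condMutualInfo, entropy_marginal, entropy_pairMarginal, entropy_pairMarginal,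
    entropy_tripleMarginal]
  linarith

/-- If exchanging the coordinates in `A` between two configurations that agree at `k`
preserves the product of their probabilities, then `X_i` (with `i ∈ A`) and `X_j`
(with `j ∉ A`) are conditionally independent given `X_k`. -/
theorem tripleMarginal_mul_marginal {k : Fin d} (A : Finset (Fin d))
    (hswap : ∀ x y : ∀ i, S i, x k = y k →
      P x * P y = P (A.piecewise x y) * P (A.piecewise y x))
    {i j : Fin d} (hi : i ∈ A) (hj : j ∉ A) (a : S i) (b : S j) (c : S k) :
    tripleMarginal P i j k (a, b, c) * marginal P k c =
      pairMarginal P i k (a, c) * pairMarginal P j k (b, c) := by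
  unfold tripleMarginal marginal pairMarginal
  rw [Finset.sum_mul_sum, Finset.sum_mul_sum, ← Finset.sum_product', ← Finset.sum_product']
  refine Finset.sum_nbij' (fun z => (A.piecewise z.1 z.2, A.piecewise z.2 z.1))
    (fun z => (A.piecewise z.1 z.2, A.piecewise z.2 z.1)) (by simp) (by simp) ?_ ?_ ?_
  · rintro ⟨x, y⟩ -
    ext v <;> by_cases hv : v ∈ A <;> simp [hv]
  · rintro ⟨x, y⟩ -
    ext v <;> by_cases hv : v ∈ A <;> simp [hv]
  · rintro ⟨x, y⟩ -
    by_cases hk : k ∈ A <;> by_cases hx : x k = c <;> by_cases hy : y k = c <;>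
      simp [hi, hj, hk, hx, hy]
    all_goals
      by_cases hxi : x i = a <;> by_cases hxj : x j = b <;> simp [hxi, hxj]
      exact hswap x y (hx.trans hy.symm)

/-- A function that factorizes along `pa` is invariant under exchanging the
coordinates in `A`, provided every edge leaving `A` ends at `k`. -/
theorem mul_eq_mul_piecewise {r : Fin d} {pa : Fin d → Fin d}
    (hfac : ∀ x, P x = marginal P r (x r) *
      ∏ i ∈ Finset.univ.erase r,
        pairMarginal P i (pa i) (x i, x (pa i)) / marginal P (pa i) (x (pa i)))
    {k : Fin d} (A : Finset (Fin d)) (hk : k ∉ A)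
    (hA : ∀ v w, pa v = w ∨ pa w = v → v ∈ A → w ≠ k → w ∈ A)
    (x y : ∀ i, S i) (hxy : x k = y k) :
    P x * P y = P (A.piecewise x y) * P (A.piecewise y x) := by
  rw [hfac x, hfac y, hfac (A.piecewise x y), hfac (A.piecewise y x)]
  rw [mul_mul_mul_comm, mul_mul_mul_comm (marginal P r (A.piecewise x y r)),
    ← Finset.prod_mul_distrib, ← Finset.prod_mul_distrib]
  congr 1
  · by_cases h : r ∈ A <;> simp [h, mul_comm]
  · refine Finset.prod_congr rfl fun v _ => ?_
    have inside : ∀ z w : ∀ i, S i, z k = w k → ∀ u, u ∈ A ∨ u = k →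
        A.piecewise z w u = z u := by
      rintro z w hzw u (hu | rfl)
      · simp [hu]
      · simp [hk, hzw]
    by_cases hv : v ∈ A
    · have hp : pa v ∈ A ∨ pa v = k := by
        by_contra! hcon
        exact hcon.1 (hA v _ (Or.inl rfl) hv hcon.2)
      rw [inside x y hxy v (.inl hv), inside y x hxy.symm v (.inl hv),
        inside x y hxy _ hp, inside y x hxy.symm _ hp]
    · by_cases hp : pa v ∈ A
      · have hvk : v = k := by
          by_contra hcon
          exact hv (hA _ v (Or.inr rfl) hp hcon)
        rw [inside x y hxy v (.inr hvk), inside y x hxy.symm v (.inr hvk),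
          inside x y hxy _ (.inl hp), inside y x hxy.symm _ (.inl hp)]
      · simp only [Finset.piecewise_eq_of_notMem _ _ _ hv,
          Finset.piecewise_eq_of_notMem _ _ _ hp]
        exact mul_comm _ _

end Marginals

/-- If the joint pmf of `X = (X_1, …, X_d)` factorizes along a rooted
tree with root `r` and parent map `pa`, then for any three distinct vertices `i, j, k`
such that `k` lies on the (unique) path in the tree between `i` and `j`,
`I(X_i ; X_j | X_k) = 0`. -/
theorem stmt_3 {d : ℕ} {S : Fin d → Type*} [∀ i, Fintype (S i)] [∀ i, DecidableEq (S i)]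
    (P : (∀ i, S i) → ℝ) (hP0 : ∀ x, 0 ≤ P x) (hP1 : ∑ x, P x = 1)
    (r : Fin d) (pa : Fin d → Fin d) (hr : pa r = r)
    (htree : ∀ i, ∃ n, pa^[n] i = r)
    (hfac : ∀ x, P x = marginal P r (x r) *
      ∏ i ∈ Finset.univ.erase r,
        pairMarginal P i (pa i) (x i, x (pa i)) / marginal P (pa i) (x (pa i)))
    (i j k : Fin d) (hij : i ≠ j) (hik : i ≠ k) (hjk : j ≠ k)
    (hpath : ∀ p : (parentGraph pa).Path i j, k ∈ p.1.support) :
    condMutualInfo P i j k = 0 := by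
  classical
  let A : Finset (Fin d) :=
    {v | ∃ p : (parentGraph pa).Walk i v, k ∉ p.support}
  have hkA : k ∉ A := by
    simp only [A, Finset.mem_filter_univ, not_exists, not_not]
    exact fun p => p.end_mem_support
  have hiA : i ∈ A := by
    simp only [A, Finset.mem_filter_univ]
    exact ⟨.nil, by simpa using hik.symm⟩
  have hjA : j ∉ A := by
    simp only [A, Finset.mem_filter_univ, not_exists, not_not]
    exact fun p => p.support_toPath_subset_support (hpath p.toPath)
  have hA : ∀ v w, pa v = w ∨ pa w = v → v ∈ A → w ≠ k → w ∈ A := by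
    intro v w hvw hv hwk
    by_cases hne : v = w
    · exact hne ▸ hv
    simp only [A, Finset.mem_filter_univ] at hv ⊢
    obtain ⟨p, hp⟩ := hv
    have hadj : (parentGraph pa).Adj v w := (SimpleGraph.fromRel_adj _ _ _).2 ⟨hne, hvw⟩
    refine ⟨p.concat hadj, ?_⟩
    simp [SimpleGraph.Walk.support_concat, hp, hwk.symm]
  exact condMutualInfo_eq_zero hP0
    (tripleMarginal_mul_marginal A (mul_eq_mul_piecewise hfac A hkA hA) hiA hjA)
end

section
/- Let S be a finite nonempty set, let P₀ and P₁ be probability mass functions on S, let θ₀, θ₁ be real numbers, and let n be a positive integer. Then for every function θ̂ : Sⁿ → ℝ, max_{i ∈ {0,1}} E_{x ~ P_i^{⊗n}}[ |θ̂(x) − θ_i| ] ≥ (|θ₀ − θ₁|/8) · exp(−n · D(P₀‖P₁)), where P_i^{⊗n} denotes the n-fold product distribution and D(P₀‖P₁) = Σ_{x ∈ S} P₀(x) ln(P₀(x)/P₁(x)) is the Kullback–Leibler divergence with natural logarithm (taken to be +∞ if P₀ is not absolutely continuous with respect to P₁). -/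
open Finset

/-- The squared Bhattacharyya affinity of two probability mass functions is at most twice
their overlap `∑ min p q`. -/
lemma sq_sum_sqrt_mul_le_two_mul_sum_min {Ω : Type*} [Fintype Ω] (p q : Ω → ℝ)
    (hp0 : ∀ x, 0 ≤ p x) (hp1 : ∑ x, p x = 1) (hq0 : ∀ x, 0 ≤ q x) (hq1 : ∑ x, q x = 1) :
    (∑ x, √(p x * q x)) ^ 2 ≤ 2 * ∑ x, min (p x) (q x) := by
  have hmin : ∀ x, 0 ≤ min (p x) (q x) := fun x => le_min (hp0 x) (hq0 x)
  have hmax : ∀ x, 0 ≤ max (p x) (q x) := fun x => (hp0 x).trans (le_max_left _ _)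
  have hcs : (∑ x, √(p x * q x)) ^ 2 ≤ (∑ x, min (p x) (q x)) * ∑ x, max (p x) (q x) := by
    refine sum_sq_le_sum_mul_sum_of_sq_le_mul _ (fun x _ => hmin x) (fun x _ => hmax x) fun x _ => ?_
    exact (by rw [Real.sq_sqrt (mul_nonneg (hp0 x) (hq0 x)), min_mul_max] : _ = _).le
  have hsum : ∑ x, max (p x) (q x) ≤ 2 := by
    calc ∑ x, max (p x) (q x) ≤ ∑ x, (p x + q x) :=
          sum_le_sum fun x _ => max_le_add_of_nonneg (hp0 x) (hq0 x)
      _ = 2 := by rw [sum_add_distrib, hp1, hq1]; norm_num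
  nlinarith [sum_nonneg fun x (_ : x ∈ univ) => hmin x]

/-- By Jensen's inequality, the Bhattacharyya affinity is at least `exp (-D(p‖q) / 2)`. -/
lemma exp_neg_half_kl_le_sum_sqrt_mul {S : Type*} [Fintype S] (p q : S → ℝ)
    (hp0 : ∀ s, 0 ≤ p s) (hp1 : ∑ s, p s = 1) (hq0 : ∀ s, 0 ≤ q s)
    (hac : ∀ s, q s = 0 → p s = 0) :
    Real.exp (-(∑ s, p s * Real.log (p s / q s)) / 2) ≤ ∑ s, √(p s * q s) := by
  have hjensen := convexOn_exp.map_sum_le (t := univ) (w := p)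
    (p := fun s => -Real.log (p s / q s) / 2) (fun s _ => hp0 s) hp1 fun _ _ => Set.mem_univ _
  simp only [smul_eq_mul] at hjensen
  calc Real.exp (-(∑ s, p s * Real.log (p s / q s)) / 2)
      = Real.exp (∑ s, p s * (-Real.log (p s / q s) / 2)) := by
        rw [← sum_neg_distrib, sum_div]
        exact congrArg _ (sum_congr rfl fun s _ => by ring)
    _ ≤ ∑ s, p s * Real.exp (-Real.log (p s / q s) / 2) := hjensen
    _ = ∑ s, √(p s * q s) := sum_congr rfl fun s _ => by
        rcases (hp0 s).eq_or_lt with h | h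
        · simp [← h]
        have hq : 0 < q s := (hq0 s).lt_of_ne fun h0 => h.ne' (hac s h0.symm)
        rw [Real.exp_half, Real.exp_neg, Real.exp_log (div_pos h hq), inv_div]
        nth_rewrite 1 [← Real.sqrt_sq h.le]
        rw [← Real.sqrt_mul (sq_nonneg _)]
        congr 1
        field_simp

/-- The sum of the two risks is at least the separation times the overlap. -/
lemma abs_sub_mul_sum_min_le_risk_add_risk {Ω : Type*} [Fintype Ω] (p q est : Ω → ℝ)
    (hp0 : ∀ x, 0 ≤ p x) (hq0 : ∀ x, 0 ≤ q x) (θ₀ θ₁ : ℝ) :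
    |θ₀ - θ₁| * ∑ x, min (p x) (q x) ≤
      ∑ x, p x * |est x - θ₀| + ∑ x, q x * |est x - θ₁| := by
  rw [mul_sum, ← sum_add_distrib]
  refine sum_le_sum fun x _ => ?_
  have htri : |θ₀ - θ₁| ≤ |est x - θ₀| + |est x - θ₁| := by
    rw [abs_sub_comm (est x) θ₀]
    exact abs_sub_le _ _ _
  calc |θ₀ - θ₁| * min (p x) (q x)
      ≤ (|est x - θ₀| + |est x - θ₁|) * min (p x) (q x) :=
        mul_le_mul_of_nonneg_right htri (le_min (hp0 x) (hq0 x))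
    _ = min (p x) (q x) * |est x - θ₀| + min (p x) (q x) * |est x - θ₁| := by ring
    _ ≤ p x * |est x - θ₀| + q x * |est x - θ₁| := by
        gcongr
        · exact min_le_left _ _
        · exact min_le_right _ _

open Classical in
/-- **Le Cam's two-point bound.** Let `P₀, P₁` be pmfs on a finite
nonempty set `S`, `θ₀, θ₁ ∈ ℝ`, `n ≥ 1`, and `est : Sⁿ → ℝ` any estimator. Then
`max_{i ∈ {0,1}} E_{x ~ P_i^{⊗n}} |est(x) − θ_i| ≥ (|θ₀ − θ₁|/8) · exp(−n·D(P₀‖P₁))`,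
where `D(P₀‖P₁) = Σ_s P₀(s) ln (P₀(s)/P₁(s))`, taken to be `+∞` (so that
`exp(−n·D) = 0`) when `P₀` is not absolutely continuous with respect to `P₁`. -/
theorem stmt_13 {S : Type*} [Fintype S] [Nonempty S]
    (P₀ P₁ : S → ℝ)
    (hP₀0 : ∀ s, 0 ≤ P₀ s) (hP₀1 : ∑ s, P₀ s = 1)
    (hP₁0 : ∀ s, 0 ≤ P₁ s) (hP₁1 : ∑ s, P₁ s = 1)
    (θ₀ θ₁ : ℝ) (n : ℕ) (hn : 1 ≤ n)
    (est : (Fin n → S) → ℝ) :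
    |θ₀ - θ₁| / 8 *
        (if ∀ s, P₁ s = 0 → P₀ s = 0 then
          Real.exp (-(n : ℝ) * ∑ s, P₀ s * Real.log (P₀ s / P₁ s))
        else 0)
      ≤ max (∑ x : Fin n → S, (∏ i, P₀ (x i)) * |est x - θ₀|)
            (∑ x : Fin n → S, (∏ i, P₁ (x i)) * |est x - θ₁|) := by
  set R₀ := ∑ x : Fin n → S, (∏ i, P₀ (x i)) * |est x - θ₀|
  set R₁ := ∑ x : Fin n → S, (∏ i, P₁ (x i)) * |est x - θ₁|
  have hprod0 : ∀ x : Fin n → S, 0 ≤ ∏ i, P₀ (x i) := fun x => prod_nonneg fun i _ => hP₀0 _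
  have hprod1 : ∀ x : Fin n → S, 0 ≤ ∏ i, P₁ (x i) := fun x => prod_nonneg fun i _ => hP₁0 _
  split_ifs with hac
  · have hrisk := abs_sub_mul_sum_min_le_risk_add_risk (fun x : Fin n → S => ∏ i, P₀ (x i))
      (fun x => ∏ i, P₁ (x i)) est hprod0 hprod1 θ₀ θ₁
    have hoverlap := sq_sum_sqrt_mul_le_two_mul_sum_min (fun x : Fin n → S => ∏ i, P₀ (x i))
      (fun x => ∏ i, P₁ (x i)) hprod0 (by rw [← Fintype.sum_pow, hP₀1, one_pow])
      hprod1 (by rw [← Fintype.sum_pow, hP₁1, one_pow])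
    have htensor : ∑ x : Fin n → S, √((∏ i, P₀ (x i)) * ∏ i, P₁ (x i)) =
        (∑ s, √(P₀ s * P₁ s)) ^ n := by
      rw [Fintype.sum_pow]
      refine sum_congr rfl fun x _ => ?_
      rw [← prod_mul_distrib, Real.sqrt_prod _ fun i _ => mul_nonneg (hP₀0 _) (hP₁0 _)]
    have hexp : Real.exp (-(n : ℝ) * ∑ s, P₀ s * Real.log (P₀ s / P₁ s)) ≤
        ((∑ s, √(P₀ s * P₁ s)) ^ n) ^ 2 := by
      calc Real.exp (-(n : ℝ) * ∑ s, P₀ s * Real.log (P₀ s / P₁ s))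
          = (Real.exp (-(∑ s, P₀ s * Real.log (P₀ s / P₁ s)) / 2) ^ n) ^ 2 := by
            rw [← Real.exp_nat_mul, ← Real.exp_nat_mul]
            congr 1
            push_cast
            ring
        _ ≤ _ := by
            gcongr
            exact exp_neg_half_kl_le_sum_sqrt_mul P₀ P₁ hP₀0 hP₀1 hP₁0 hac
    rw [htensor] at hoverlap
    have hsep := mul_le_mul_of_nonneg_left (hexp.trans hoverlap) (abs_nonneg (θ₀ - θ₁))
    have hpos := mul_nonneg (abs_nonneg (θ₀ - θ₁))
      (Real.exp_pos (-(n : ℝ) * ∑ s, P₀ s * Real.log (P₀ s / P₁ s))).le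
    linarith [le_max_left R₀ R₁, le_max_right R₀ R₁]
  · rw [mul_zero]
    exact le_max_of_le_left (sum_nonneg fun x _ => mul_nonneg (hprod0 x) (abs_nonneg _))
end

section
/- For every ε ∈ (0, 1/2) and every positive integer n, and for every function θ̂ : {0,1}ⁿ → ℝ, max_{p ∈ {1/2, 1/2 − ε}} E_{x ~ Bern(p)^{⊗n}}[ |θ̂(x) − H₂(p)| ] ≥ (ε²/4)·(1 − 4ε²)^{n/2}. -/
open Finset

/-- The binary Shannon entropy `H₂(p) = −p log₂ p − (1 − p) log₂ (1 − p)`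
(with `0 log₂ 0 = 0`, as guaranteed by Lean's convention `Real.logb 2 0 = 0`). -/
noncomputable def binEntropy (p : ℝ) : ℝ :=
  -(p * Real.logb 2 p) - (1 - p) * Real.logb 2 (1 - p)

/-- The expected absolute error of the estimator `est` of `H₂(p)` from `n` i.i.d.
`Bern(p)` samples. -/
noncomputable def bernRisk (n : ℕ) (p : ℝ) (est : (Fin n → Bool) → ℝ) : ℝ :=
  ∑ x : Fin n → Bool, (∏ i, if x i then p else 1 - p) * |est x - binEntropy p|

theorem sq_div_two_le_log_sum {t : ℝ} (h0 : 0 < t) (h1 : t < 1) :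
    t ^ 2 / 2 ≤ (1 - t) * Real.log (1 - t) + (1 + t) * Real.log (1 + t) := by
  have hsub : Real.log (1 - t) = Real.log (1 - t ^ 2) - Real.log (1 + t) := by
    rw [show 1 - t ^ 2 = (1 - t) * (1 + t) by ring,
      Real.log_mul (by linarith) (by linarith)]
    ring
  have hplus := Real.le_log_one_add_of_nonneg h0.le
  have hpos : 0 < 1 - t ^ 2 := by nlinarith
  have hminus := Real.one_sub_inv_le_log_of_pos hpos
  have hl : (1 - t) * (1 - (1 - t ^ 2)⁻¹) + 2 * t * (2 * t / (t + 2))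
      ≤ (1 - t) * Real.log (1 - t ^ 2) + 2 * t * Real.log (1 + t) := by
    have := sub_pos.2 h1
    gcongr
  have hr : (1 - t) * (1 - (1 - t ^ 2)⁻¹) + 2 * t * (2 * t / (t + 2))
      = t ^ 2 * ((2 + 3 * t) / ((1 + t) * (2 + t))) := by
    have : 1 - t ≠ 0 := by linarith
    have : 1 + t ≠ 0 := by linarith
    have : t + 2 ≠ 0 := by linarith
    have : 2 + t ≠ 0 := by linarith
    rw [show 1 - t ^ 2 = (1 - t) * (1 + t) by ring]
    field_simp
    ring
  have hq : 1 / 2 ≤ (2 + 3 * t) / ((1 + t) * (2 + t)) := by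
    rw [div_le_div_iff₀ (by norm_num) (by positivity)]
    nlinarith
  rw [hsub]
  nlinarith [mul_le_mul_of_nonneg_left hq (sq_nonneg t)]

theorem binEntropy_one_half : binEntropy (1 / 2) = 1 := by
  have h : Real.logb 2 (1 / 2) = -1 := by
    rw [one_div, Real.logb_inv, Real.logb_self_eq_one (by norm_num)]
  rw [binEntropy, show (1 : ℝ) - 1 / 2 = 1 / 2 by norm_num, h]
  norm_num

theorem sq_le_binEntropy_gap {ε : ℝ} (h0 : 0 < ε) (h1 : ε < 1 / 2) :
    ε ^ 2 ≤ binEntropy (1 / 2) - binEntropy (1 / 2 - ε) := by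
  have key := sq_div_two_le_log_sum (t := 2 * ε) (by linarith) (by linarith)
  have hlog : 0 < Real.log 2 := Real.log_pos (by norm_num)
  have hlog1 : Real.log 2 < 1 := by linarith [Real.log_two_lt_d9]
  have ha : Real.log (1 / 2 - ε) = Real.log (1 - 2 * ε) - Real.log 2 := by
    rw [← Real.log_div (by linarith) (by norm_num)]
    congr 1; ring
  have hb : Real.log (1 - (1 / 2 - ε)) = Real.log (1 + 2 * ε) - Real.log 2 := by
    rw [← Real.log_div (by linarith) (by norm_num)]
    congr 1; ring
  have heq : 1 - binEntropy (1 / 2 - ε) =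
      ((1 - 2 * ε) * Real.log (1 - 2 * ε) + (1 + 2 * ε) * Real.log (1 + 2 * ε))
        / 2 / Real.log 2 := by
    rw [binEntropy, Real.logb, Real.logb, ha, hb]
    field_simp
    ring
  rw [binEntropy_one_half, heq, le_div_iff₀ hlog]
  nlinarith [sq_nonneg ε]

/-- Le Cam's two-point bound for two weight functions on a finite type. -/
theorem mul_sum_min_le_sum_add_sum {α : Type*} [Fintype α] (P Q f : α → ℝ)
    (hP : ∀ x, 0 ≤ P x) (hQ : ∀ x, 0 ≤ Q x) (a b : ℝ) :
    (a - b) * ∑ x, min (P x) (Q x) ≤ ∑ x, P x * |f x - a| + ∑ x, Q x * |f x - b| := by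
  rw [mul_sum, ← sum_add_distrib]
  refine sum_le_sum fun x _ => ?_
  have hab : a - b ≤ |f x - a| + |f x - b| := by
    linarith [neg_abs_le (f x - a), le_abs_self (f x - b)]
  calc (a - b) * min (P x) (Q x)
      ≤ (|f x - a| + |f x - b|) * min (P x) (Q x) :=
        mul_le_mul_of_nonneg_right hab (le_min (hP x) (hQ x))
    _ = min (P x) (Q x) * |f x - a| + min (P x) (Q x) * |f x - b| := by ring
    _ ≤ P x * |f x - a| + Q x * |f x - b| := by
        gcongr
        · exact min_le_left _ _
        · exact min_le_right _ _

/-- The squared Bhattacharyya coefficient is at most twice the overlap. -/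
theorem sq_sum_sqrt_mul_le_two_mul_sum_min_s14 {α : Type*} [Fintype α] (P Q r : α → ℝ)
    (hP : ∀ x, 0 ≤ P x) (hQ : ∀ x, 0 ≤ Q x) (hP1 : ∑ x, P x = 1) (hQ1 : ∑ x, Q x = 1)
    (hr : ∀ x, r x ^ 2 = P x * Q x) :
    (∑ x, r x) ^ 2 ≤ 2 * ∑ x, min (P x) (Q x) := by
  have hmin : 0 ≤ ∑ x, min (P x) (Q x) := sum_nonneg fun x _ => le_min (hP x) (hQ x)
  have hmax : ∑ x, max (P x) (Q x) ≤ 2 := by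
    calc ∑ x, max (P x) (Q x) ≤ ∑ x, (P x + Q x) :=
          sum_le_sum fun x _ => max_le (by linarith [hQ x]) (by linarith [hP x])
      _ = 2 := by rw [sum_add_distrib, hP1, hQ1]; norm_num
  have hcs := sum_sq_le_sum_mul_sum_of_sq_le_mul univ
    (r := r) (f := fun x => min (P x) (Q x)) (g := fun x => max (P x) (Q x))
    (fun x _ => le_min (hP x) (hQ x)) (fun x _ => le_max_of_le_left (hP x))
    (fun x _ => by rw [hr, min_mul_max])
  nlinarith

theorem sum_prod_bernoulli (n : ℕ) (p : ℝ) :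
    ∑ x : Fin n → Bool, ∏ i, (if x i then p else 1 - p) = 1 := by
  rw [← Fintype.sum_pow (fun b : Bool => if b then p else 1 - p) n]
  simp

theorem prod_bernoulli_nonneg {n : ℕ} {p : ℝ} (h0 : 0 ≤ p) (h1 : p ≤ 1) (x : Fin n → Bool) :
    0 ≤ ∏ i, (if x i then p else 1 - p) :=
  prod_nonneg fun i _ => by split_ifs <;> linarith

theorem rpow_le_two_mul_sum_min_bernoulli {ε : ℝ} (h0 : 0 < ε) (h1 : ε < 1 / 2) (n : ℕ) :
    (1 - 4 * ε ^ 2) ^ ((n : ℝ) / 2) ≤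
      2 * ∑ x : Fin n → Bool, min (∏ i, if x i then (1 / 2 : ℝ) else 1 - 1 / 2)
        (∏ i, if x i then 1 / 2 - ε else 1 - (1 / 2 - ε)) := by
  set g : Bool → ℝ := fun b =>
    √((if b then (1 / 2 : ℝ) else 1 - 1 / 2) * (if b then 1 / 2 - ε else 1 - (1 / 2 - ε))) with hg
  have hCS := sq_sum_sqrt_mul_le_two_mul_sum_min_s14
    (fun x : Fin n → Bool => ∏ i, if x i then (1 / 2 : ℝ) else 1 - 1 / 2)
    (fun x => ∏ i, if x i then 1 / 2 - ε else 1 - (1 / 2 - ε)) (fun x => ∏ i, g (x i))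
    (prod_bernoulli_nonneg (by norm_num) (by norm_num))
    (prod_bernoulli_nonneg (by linarith) (by linarith))
    (sum_prod_bernoulli n _) (sum_prod_bernoulli n _)
    (fun x => by
      rw [← prod_pow, ← prod_mul_distrib]
      refine prod_congr rfl fun i _ => Real.sq_sqrt ?_
      split_ifs
      · exact mul_nonneg (by norm_num) (by linarith)
      · exact mul_nonneg (by norm_num) (by linarith))
  refine le_trans ?_ hCS
  have hpos : 0 ≤ 1 - 4 * ε ^ 2 := by nlinarith
  rw [← Fintype.sum_pow g n, ← pow_mul, mul_comm n 2, pow_mul, div_eq_inv_mul,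
    Real.rpow_mul hpos, Real.rpow_natCast, inv_eq_one_div, ← Real.sqrt_eq_rpow]
  refine pow_le_pow_left₀ (Real.sqrt_nonneg _) ?_ n
  have hT : g true ^ 2 = 1 / 2 * (1 / 2 - ε) := by
    simp only [hg, if_true]
    exact Real.sq_sqrt (mul_nonneg (by norm_num) (by linarith))
  have hF : g false ^ 2 = 1 / 2 * (1 / 2 + ε) := by
    simp only [hg, Bool.false_eq_true, if_false]
    rw [Real.sq_sqrt (mul_nonneg (by norm_num) (by linarith))]
    ring
  have hTF : 0 ≤ g true * g false := mul_nonneg (Real.sqrt_nonneg _) (Real.sqrt_nonneg _)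
  have hprod : √(1 - 4 * ε ^ 2) = 4 * (g true * g false) := by
    rw [Real.sqrt_eq_iff_mul_self_eq hpos (by positivity)]
    linear_combination -16 * g false ^ 2 * hT - 8 * (1 / 2 - ε) * hF
  rw [Fintype.sum_bool, hprod]
  nlinarith [sq_nonneg (g true - g false)]

/-- For every `ε ∈ (0, 1/2)`, every `n ≥ 1` and every estimator
`est : {0,1}ⁿ → ℝ`,
`max_{p ∈ {1/2, 1/2−ε}} E_{x ~ Bern(p)^{⊗n}} |est(x) − H₂(p)| ≥ (ε²/4)·(1 − 4ε²)^{n/2}`. -/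
theorem stmt_14 (ε : ℝ) (hε : ε ∈ Set.Ioo (0 : ℝ) (1 / 2))
    (n : ℕ) (hn : 1 ≤ n) (est : (Fin n → Bool) → ℝ) :
    ε ^ 2 / 4 * (1 - 4 * ε ^ 2) ^ ((n : ℝ) / 2)
      ≤ max (bernRisk n (1 / 2) est) (bernRisk n (1 / 2 - ε) est) := by
  obtain ⟨h0, h1⟩ := hε
  have hlc := mul_sum_min_le_sum_add_sum
    (fun x : Fin n → Bool => ∏ i, if x i then (1 / 2 : ℝ) else 1 - 1 / 2)
    (fun x => ∏ i, if x i then 1 / 2 - ε else 1 - (1 / 2 - ε)) est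
    (prod_bernoulli_nonneg (by norm_num) (by norm_num))
    (prod_bernoulli_nonneg (by linarith) (by linarith))
    (binEntropy (1 / 2)) (binEntropy (1 / 2 - ε))
  have hmin := rpow_le_two_mul_sum_min_bernoulli h0 h1 n
  have hgap := sq_le_binEntropy_gap h0 h1
  have hpos : 0 ≤ (1 - 4 * ε ^ 2) ^ ((n : ℝ) / 2) := Real.rpow_nonneg (by nlinarith) _
  have hmul := mul_le_mul hgap hmin hpos ((sq_nonneg ε).trans hgap)
  change _ ≤ bernRisk n (1 / 2) est + bernRisk n (1 / 2 - ε) est at hlc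
  linarith [le_max_left (bernRisk n (1 / 2) est) (bernRisk n (1 / 2 - ε) est),
    le_max_right (bernRisk n (1 / 2) est) (bernRisk n (1 / 2 - ε) est)]
end

section
/- Let S be a finite nonempty set, p a probability mass function on S, K ≥ 1 an integer, and λ ∈ [0, 1]. Let the following be mutually independent: x and x' each distributed according to p; h drawn uniformly at random from the set of all functions S → {1, …, K}; B and B' each Bernoulli with parameter λ; and U, U' each uniform on {1, …, K}. Define v = h(x) if B = 1 and v = U otherwise, and v' = h(x') if B' = 1 and v' = U' otherwise. Then Pr[v = v'] = λ²·(1 − 1/K)·Σ_{s ∈ S} p(s)² + 1/K. -/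
open Finset

/-- A uniformly random function takes equal values at two distinct points with
probability `1 / K`. -/
theorem card_mul_sum_apply_eq_apply {S : Type*} [Fintype S] [DecidableEq S]
    (K : ℕ) [NeZero K] {x y : S} (hxy : x ≠ y) :
    (K : ℝ) * ∑ h : S → Fin K, (if h x = h y then (1 : ℝ) else 0)
      = (Fintype.card (S → Fin K) : ℝ) := by
  have shift (c : Fin K) : ∑ h : S → Fin K, (if h x = h y then (1 : ℝ) else 0)
      = ∑ h : S → Fin K, (if c = h y - h x then (1 : ℝ) else 0) := by
    rw [← Equiv.sum_comp (Equiv.addRight (Pi.single x c : S → Fin K))]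
    refine Finset.sum_congr rfl fun h _ => ?_
    simp [hxy.symm, eq_sub_iff_add_eq, add_comm]
  calc (K : ℝ) * ∑ h : S → Fin K, (if h x = h y then (1 : ℝ) else 0)
      = ∑ _c : Fin K, ∑ h : S → Fin K, (if h x = h y then (1 : ℝ) else 0) := by simp
    _ = ∑ c : Fin K, ∑ h : S → Fin K, (if c = h y - h x then (1 : ℝ) else 0) :=
        Finset.sum_congr rfl fun c _ => shift c
    _ = (Fintype.card (S → Fin K) : ℝ) := by
        rw [Finset.sum_comm]
        simp

/-- The collision probability of two independently randomized responses to fixed hash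
values `a` and `a'`, up to a constant weight `w`. -/
theorem sum_randomized_response_collision (K : ℕ) [NeZero K] (w lam : ℝ) (a a' : Fin K) :
    (∑ b : Bool, ∑ b' : Bool, ∑ u : Fin K, ∑ u' : Fin K,
        (w * (if b then lam else 1 - lam) * (if b' then lam else 1 - lam)
            * (1 / (K : ℝ)) * (1 / (K : ℝ)))
          * (if (if b then a else u) = (if b' then a' else u') then (1 : ℝ) else 0))
      = w * (lam ^ 2 * (if a = a' then (1 : ℝ) else 0) + (1 - lam ^ 2) / K) := by
  have hK : (K : ℝ) ≠ 0 := NeZero.ne _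
  simp only [Fintype.sum_bool, ← Finset.mul_sum]
  simp
  field_simp
  split_ifs <;> ring

/-- Let `p` be a pmf on a finite nonempty set `S`, `K ≥ 1`, and
`λ ∈ [0, 1]`. Draw, mutually independently: `x, x' ~ p`; a uniformly random function
`h : S → {1, …, K}`; `B, B' ~ Bernoulli(λ)`; and `u, u'` uniform on `{1, …, K}`. Set
`v = h(x)` if `B = 1` else `v = u`, and `v' = h(x')` if `B' = 1` else `v' = u'`. Then
`Pr[v = v'] = λ²·(1 − 1/K)·Σ_s p(s)² + 1/K`. The left-hand side below is this
probability, written as a sum over the (finite) product sample space with the product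
weights of the independent components. -/
theorem stmt_17 {S : Type*} [Fintype S] [Nonempty S] [DecidableEq S]
    (p : S → ℝ) (hp0 : ∀ s, 0 ≤ p s) (hp1 : ∑ s, p s = 1)
    (K : ℕ) (hK : 1 ≤ K) (lam : ℝ) (hlam : lam ∈ Set.Icc (0 : ℝ) 1) :
    (∑ x : S, ∑ x' : S, ∑ h : S → Fin K, ∑ b : Bool, ∑ b' : Bool,
      ∑ u : Fin K, ∑ u' : Fin K,
        (p x * p x' * (1 / (Fintype.card (S → Fin K) : ℝ))
            * (if b then lam else 1 - lam) * (if b' then lam else 1 - lam)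
            * (1 / (K : ℝ)) * (1 / (K : ℝ)))
          * (if (if b then h x else u) = (if b' then h x' else u') then (1 : ℝ) else 0))
      = lam ^ 2 * (1 - 1 / (K : ℝ)) * (∑ s, p s ^ 2) + 1 / (K : ℝ) := by
  have : NeZero K := ⟨by omega⟩
  have hK0 : (K : ℝ) ≠ 0 := NeZero.ne _
  have hN : (Fintype.card (S → Fin K) : ℝ) ≠ 0 := by
    exact_mod_cast Fintype.card_ne_zero
  simp only [sum_randomized_response_collision]
  have average (x x' : S) : ∑ h : S → Fin K, p x * p x' * (1 / (Fintype.card (S → Fin K) : ℝ))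
        * (lam ^ 2 * (if h x = h x' then (1 : ℝ) else 0) + (1 - lam ^ 2) / K)
      = lam ^ 2 * (1 - 1 / (K : ℝ)) * (if x = x' then p x * p x' else 0)
        + 1 / (K : ℝ) * (p x * p x') := by
    rw [← Finset.mul_sum, Finset.sum_add_distrib, ← Finset.mul_sum, Finset.sum_const,
      Finset.card_univ, nsmul_eq_mul]
    by_cases hx : x = x'
    · subst hx
      simp only [if_true, Finset.sum_const, Finset.card_univ, nsmul_eq_mul]
      field_simp
      ring
    · have hcol := card_mul_sum_apply_eq_apply K hx
      rw [if_neg hx, ← hcol]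
      rw [← hcol] at hN
      have hsum := right_ne_zero_of_mul hN
      field_simp
      ring
  simp only [average, Finset.sum_add_distrib, ← Finset.mul_sum, hp1]
  simp [hp1, pow_two]
end
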